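/- arXiv:2409.11792 — 3 statements merged into one kernel-verified Lean document; each statement's English description precedes it below -/
import Mathlib

section
/- Let ε' > 0 be a real number and set ε = ε' / (2 + ε'). Let n be a natural number and let D and C be probability distributions on binary strings of length n with D y > 0 for every string y. If |C y / D y − 1| ≤ ε for all strings y, then |C̄(k, b, y') − D̄(k, b, y')| ≤ ε' for every index k : Fin n, every bit b : Bool, and every string y' : Fin n → Bool. In particular the ε in the previous lemma can be chosen uniformly, independent of n and D. -/
/-- The conditional probability of the `k`-th bit being `b`, given that all other bits
agree with `y'`, under the (unnormalized) distribution `D`. -/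
noncomputable def condProb {n : ℕ} (D : (Fin n → Bool) → ℝ) (k : Fin n) (b : Bool)
    (y' : Fin n → Bool) : ℝ :=
  D (Function.update y' k b) /
    (D (Function.update y' k false) + D (Function.update y' k true))

theorem div_le_div_add_of_mul_le {a S c T δ : ℝ} (hδ : 0 ≤ δ) (hS : 0 < S) (hT : 0 < T)
    (haS : a ≤ S) (h : c * S ≤ (1 + δ) * (a * T)) : c / T ≤ a / S + δ := by
  have h₁ : c / T ≤ (1 + δ) * a / S := by
    rw [div_le_div_iff₀ hT hS]
    linarith
  have h₂ : a / S ≤ 1 := (div_le_one hS).2 haS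
  have h₃ : (1 + δ) * a / S = a / S + δ * (a / S) := by ring
  nlinarith

theorem abs_div_sub_div_le {a S c T ε δ : ℝ} (hδ : 0 < δ) (hε : ε = δ / (2 + δ))
    (ha : 0 < a) (haS : a ≤ S) (hcT : c ≤ T)
    (hc : (1 - ε) * a ≤ c ∧ c ≤ (1 + ε) * a) (hT : (1 - ε) * S ≤ T ∧ T ≤ (1 + ε) * S) :
    |c / T - a / S| ≤ δ := by
  have hS : 0 < S := ha.trans_le haS
  have hε₁ : 0 < 1 - ε := by
    have : ε < 1 := by rw [hε, div_lt_one (by linarith)]; linarith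
    linarith
  have hεδ : 1 + ε = (1 + δ) * (1 - ε) := by rw [hε]; field_simp; ring
  have hT₀ : 0 < T := (mul_pos hε₁ hS).trans_le hT.1
  have hδ₁ : 0 < 1 + δ := by linarith
  rw [hεδ] at hc hT
  have h₁ : c / T ≤ a / S + δ := by
    apply div_le_div_add_of_mul_le hδ.le hS hT₀ haS
    calc c * S ≤ (1 + δ) * (1 - ε) * a * S := by gcongr; exact hc.2
      _ = (1 + δ) * (a * ((1 - ε) * S)) := by ring
      _ ≤ (1 + δ) * (a * T) := by gcongr; exact hT.1
  have h₂ : a / S ≤ c / T + δ := by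
    apply div_le_div_add_of_mul_le hδ.le hT₀ hS hcT
    calc a * T ≤ a * ((1 + δ) * (1 - ε) * S) := by gcongr; exact hT.2
      _ = (1 + δ) * ((1 - ε) * a * S) := by ring
      _ ≤ (1 + δ) * (c * S) := by gcongr; exact hc.1
  rw [abs_le]
  constructor <;> linarith

theorem stmt_1 (ε' : ℝ) (hε' : 0 < ε') (ε : ℝ) (hε : ε = ε' / (2 + ε'))
    (n : ℕ) (D C : (Fin n → Bool) → ℝ)
    (hDpos : ∀ y, 0 < D y) (hDsum : ∑ y, D y = 1)
    (hCnonneg : ∀ y, 0 ≤ C y) (hCsum : ∑ y, C y = 1)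
    (hclose : ∀ y, |C y / D y - 1| ≤ ε) :
    ∀ (k : Fin n) (b : Bool) (y' : Fin n → Bool),
      |condProb C k b y' - condProb D k b y'| ≤ ε' := by
  intro k b y'
  have hb : ∀ y, (1 - ε) * D y ≤ C y ∧ C y ≤ (1 + ε) * D y := by
    intro y
    have h := abs_le.1 (hclose y)
    rw [← le_div_iff₀ (hDpos y), ← div_le_iff₀ (hDpos y)]
    constructor <;> linarith [h.1, h.2]
  have hf := hb (Function.update y' k false)
  have ht := hb (Function.update y' k true)
  have le_sum : ∀ E : (Fin n → Bool) → ℝ, (∀ y, 0 ≤ E y) → E (Function.update y' k b) ≤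
      E (Function.update y' k false) + E (Function.update y' k true) := by
    intro E hE
    have := hE (Function.update y' k false)
    have := hE (Function.update y' k true)
    cases b <;> linarith
  exact abs_div_sub_div_le hε' hε (hDpos _) (le_sum D fun y => (hDpos y).le)
    (le_sum C hCnonneg) (hb _) ⟨by linarith [hf.1, ht.1], by linarith [hf.2, ht.2]⟩
end

section
/- Let A, B, a, b, ε be real numbers with A ≥ 0, B ≥ 0, A + B > 0, 0 ≤ ε < 1, A·(1 − ε) ≤ a ≤ A·(1 + ε), and B·(1 − ε) ≤ b ≤ B·(1 + ε). Then a / (a + b) ≥ A / (A + B) − 2ε / (1 + ε). -/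
theorem stmt_3 (A B a b ε : ℝ)
    (hA : 0 ≤ A) (hB : 0 ≤ B) (hAB : 0 < A + B)
    (hε0 : 0 ≤ ε) (hε1 : ε < 1)
    (ha1 : A * (1 - ε) ≤ a) (ha2 : a ≤ A * (1 + ε))
    (hb1 : B * (1 - ε) ≤ b) (hb2 : b ≤ B * (1 + ε)) :
    a / (a + b) ≥ A / (A + B) - 2 * ε / (1 + ε) := by
  have hm : 0 < 1 - ε := by linarith
  have hp : 0 < 1 + ε := by linarith
  have hS : 0 < (A + B) * (1 - ε) := mul_pos hAB hm
  have hab : 0 < a + b := by linarith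
  have hD : 0 < A * (1 - ε) + B * (1 + ε) := by
    linarith [mul_nonneg hB hε0]
  have hmono : A * (1 - ε) / (A * (1 - ε) + B * (1 + ε)) ≤ a / (a + b) := by
    rw [div_le_div_iff₀ hD hab]
    have h₁ : A * (1 - ε) * b ≤ A * (1 - ε) * (B * (1 + ε)) :=
      mul_le_mul_of_nonneg_left hb2 (mul_nonneg hA hm.le)
    have h₂ : A * (1 - ε) * (B * (1 + ε)) ≤ a * (B * (1 + ε)) :=
      mul_le_mul_of_nonneg_right ha1 (mul_nonneg hB hp.le)
    linarith
  have hdiff : A / (A + B) - A * (1 - ε) / (A * (1 - ε) + B * (1 + ε)) =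
      2 * ε * (A * B) / ((A + B) * (A * (1 - ε) + B * (1 + ε))) := by
    rw [div_sub_div _ _ hAB.ne' hD.ne']
    ring
  have hbound : 2 * ε * (A * B) / ((A + B) * (A * (1 - ε) + B * (1 + ε))) ≤
      2 * ε / (1 + ε) := by
    rw [div_le_div_iff₀ (mul_pos hAB hD) hp, mul_assoc (2 * ε)]
    refine mul_le_mul_of_nonneg_left ?_ (by linarith)
    linarith [mul_nonneg (mul_nonneg hA hA) hm.le, mul_nonneg (mul_nonneg hB hB) hp.le,
      mul_nonneg (mul_nonneg hA hB) hm.le]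
  linarith
end

section
/- Let Y be a type, let E be a finite set (Finset) of elements of Y, let ε be a real number with 0 ≤ ε < 1, and let D, C : Y → ℝ be functions that are nonnegative on E. Assume ∑_{y ∈ E} D y > 0 and |C y − D y| ≤ ε · D y for every y ∈ E. Then for every subset A ⊆ E, |(∑_{y ∈ A} C y) / (∑_{y ∈ E} C y) − (∑_{y ∈ A} D y) / (∑_{y ∈ E} D y)| ≤ 2ε / (1 − ε). -/
theorem Finset.abs_sum_sub_sum_le_mul_sum {Y : Type*} {s : Finset Y} {ε : ℝ} {D C : Y → ℝ}
    (h : ∀ y ∈ s, |C y - D y| ≤ ε * D y) :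
    |∑ y ∈ s, C y - ∑ y ∈ s, D y| ≤ ε * ∑ y ∈ s, D y := by
  rw [← Finset.sum_sub_distrib, Finset.mul_sum]
  exact (Finset.abs_sum_le_sum_abs _ _).trans (Finset.sum_le_sum h)

theorem abs_div_sub_div_le_of_abs_sub_le {c d S T ε : ℝ} (hε0 : 0 ≤ ε) (hε1 : ε < 1)
    (hd : 0 ≤ d) (hdT : d ≤ T) (hT : 0 < T)
    (hc : |c - d| ≤ ε * d) (hS : |S - T| ≤ ε * T) :
    |c / S - d / T| ≤ 2 * ε / (1 - ε) := by
  have hST : (1 - ε) * T ≤ S := by linarith [(abs_le.mp hS).1]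
  have hε : 0 < 1 - ε := sub_pos.mpr hε1
  have hSpos : 0 < S := (mul_pos hε hT).trans_le hST
  have hnum : |c * T - S * d| ≤ 2 * ε * (T * T) :=
    calc |c * T - S * d| = |(c - d) * T - (S - T) * d| := by ring_nf
      _ ≤ |c - d| * T + |S - T| * d := by
        simpa only [abs_mul, abs_of_pos hT, abs_of_nonneg hd] using
          abs_sub ((c - d) * T) ((S - T) * d)
      _ ≤ ε * d * T + ε * T * d := by gcongr
      _ = 2 * ε * (d * T) := by ring
      _ ≤ 2 * ε * (T * T) := by gcongr
  rw [div_sub_div _ _ hSpos.ne' hT.ne', abs_div, abs_of_pos (mul_pos hSpos hT),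
    div_le_div_iff₀ (mul_pos hSpos hT) hε]
  calc |c * T - S * d| * (1 - ε) ≤ 2 * ε * (T * T) * (1 - ε) := by gcongr
    _ = 2 * ε * ((1 - ε) * T * T) := by ring
    _ ≤ 2 * ε * (S * T) := by gcongr

theorem stmt_5 {Y : Type*} (E : Finset Y) (ε : ℝ) (hε0 : 0 ≤ ε) (hε1 : ε < 1)
    (D C : Y → ℝ)
    (hDnonneg : ∀ y ∈ E, 0 ≤ D y) (hCnonneg : ∀ y ∈ E, 0 ≤ C y)
    (hDsum : 0 < ∑ y ∈ E, D y)
    (hclose : ∀ y ∈ E, |C y - D y| ≤ ε * D y) :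
    ∀ A ⊆ E,
      |(∑ y ∈ A, C y) / (∑ y ∈ E, C y) - (∑ y ∈ A, D y) / (∑ y ∈ E, D y)| ≤
        2 * ε / (1 - ε) := by
  intro A hA
  exact abs_div_sub_div_le_of_abs_sub_le hε0 hε1
    (Finset.sum_nonneg fun y hy => hDnonneg y (hA hy))
    (Finset.sum_le_sum_of_subset_of_nonneg hA fun y hy _ => hDnonneg y hy) hDsum
    (Finset.abs_sum_sub_sum_le_mul_sum fun y hy => hclose y (hA hy))
    (Finset.abs_sum_sub_sum_le_mul_sum hclose)
end
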